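/- Let T be a triangulated category and t a real number. Then: (i) for all objects X,Y,Z of T, δ_t(X ⊕ Y, Z) ≤ δ_t(X, Z); (ii) for all objects X,Y and integers n, δ_t(X, Y[n]) = δ_t(X,Y)·e^{nt}; (iii) if Y, Y_1, …, Y_r are objects with Y ∈ Y_1 * ⋯ * Y_r, then δ_t(X, Y) ≤ Σ_{i=1}^r δ_t(X, Y_i) for every object X. -/

import Mathlib

open CategoryTheory Limits Pretriangulated Filter IsLocalRing
open scoped ENNReal

universe u v

namespace CatEntropy

variable {C : Type*} [Category C] [Preadditive C] [HasZeroObject C]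
  [HasShift C ℤ] [∀ n : ℤ, (shiftFunctor C n).Additive] [Pretriangulated C]

/-- The star operation on classes of objects of a pretriangulated category:
`Z ∈ S₁ * S₂` iff there is a distinguished triangle `X ⟶ Z ⟶ Y ⟶ X⟦1⟧` with `X ∈ S₁`, `Y ∈ S₂`. -/
def starSet (S₁ S₂ : Set C) : Set C :=
  {Z | ∃ X ∈ S₁, ∃ Y ∈ S₂, ∃ (f : X ⟶ Z) (g : Z ⟶ Y) (h : Y ⟶ X⟦(1 : ℤ)⟧),
    Triangle.mk f g h ∈ distTriang C}

/-- The isomorphism class of an object, as a set of objects. -/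
def isoClass (X : C) : Set C := {Z | Nonempty (Z ≅ X)}

/-- `X₁ * X₂ * ⋯ * Xᵣ` (associated as `(⋯(X₁ * X₂) * ⋯) * Xᵣ`) for a list of objects. -/
def listStar : List C → Set C
  | [] => ∅
  | X :: L => L.foldl (fun S Y => starSet S (isoClass Y)) (isoClass X)

/-- The complexity `δ_t(X, Y)` of `Y` relative to `X`, computed inside the (triangulated)
subcategory of the ambient category `C` whose objects form the class `S`: the infimum of
the sums `∑ exp (nᵢ * t)` over all ways of writing `Y ⊕ Y' ∈ X⟦n₁⟧ * ⋯ * X⟦nᵣ⟧`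
with `Y'` in `S`. -/
noncomputable def complexity (S : Set C) (t : ℝ) (X Y : C) : ℝ≥0∞ :=
  sInf { c : ℝ≥0∞ | ∃ (l : List ℤ) (Y' : C), l ≠ [] ∧ Y' ∈ S ∧
      (Y ⊞ Y') ∈ listStar (l.map (fun n => (shiftFunctor C n).obj X)) ∧
      c = ENNReal.ofReal ((l.map (fun n => Real.exp ((n : ℝ) * t))).sum) }

/-- `P` is (the class of objects of) a thick subcategory of the triangulated subcategory of `C`
whose class of objects is `S`: it is closed under isomorphisms, shifts, extensions
and direct summands. -/
def IsThickIn (S P : Set C) : Prop :=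
  P ⊆ S ∧
  (∀ ⦃X Y : C⦄, Nonempty (X ≅ Y) → X ∈ P → Y ∈ S → Y ∈ P) ∧
  (∀ (X : C) (n : ℤ), X ∈ P → (shiftFunctor C n).obj X ∈ S → (shiftFunctor C n).obj X ∈ P) ∧
  (∀ T : Triangle C, (T ∈ distTriang C) → T.obj₃ ∈ S → T.obj₁ ∈ P → T.obj₂ ∈ P → T.obj₃ ∈ P) ∧
  (∀ X Y : C, X ∈ S → Y ∈ S → (X ⊞ Y) ∈ P → X ∈ P)

/-- `G` is a split generator of the triangulated subcategory of `C` with class of objects `S`: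
the smallest thick subcategory containing `G` is the whole subcategory. -/
def IsSplitGeneratorIn (S : Set C) (G : C) : Prop :=
  G ∈ S ∧ ∀ P : Set C, IsThickIn S P → G ∈ P → S ⊆ P

open scoped Classical in
/-- The categorical entropy `h_t(Φ)` of an endofunctor `Φ` of the triangulated subcategory of `C`
with class of objects `S`, computed using the split generator `G`:
`h_t(Φ) = lim (1/n) log δ_t(G, Φⁿ G)` if `δ_t(G, Φⁿ G) ≠ 0` for all `n ≫ 0`,
and `-∞` otherwise. -/
noncomputable def entropy (S : Set C) (Φ : C ⥤ C) (G : C) (t : ℝ) : EReal :=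
  if ∀ᶠ (n : ℕ) in atTop, complexity S t G ((fun Z => Φ.obj Z)^[n] G) ≠ 0 then
    limsup (fun n : ℕ =>
      ENNReal.log (complexity S t G ((fun Z => Φ.obj Z)^[n] G)) * (((n : ℝ)⁻¹ : ℝ) : EReal)) atTop
  else ⊥

end CatEntropy

namespace CatEntropy

section Helpers

variable {C : Type*} [Category C] [Preadditive C] [HasZeroObject C]
  [HasShift C ℤ] [∀ n : ℤ, (shiftFunctor C n).Additive] [Pretriangulated C]

lemma snocInd {α : Type*} {P : List α → Prop} (h1 : ∀ a, P [a])
    (h2 : ∀ L a, L ≠ [] → P L → P (L ++ [a])) (L : List α) (hL : L ≠ []) : P L := by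
  induction L using List.reverseRecOn with
  | nil => exact absurd rfl hL
  | append_singleton L a ih =>
    by_cases h : L = []
    · subst h; exact h1 a
    · exact h2 L a h (ih h)

lemma listStar_snoc (L : List C) (a : C) (hL : L ≠ []) :
    listStar (L ++ [a]) = starSet (listStar L) (isoClass a) := by
  cases L with
  | nil => exact absurd rfl hL
  | cons b L => simp [listStar, List.foldl_append]

lemma ne_nil_of_mem {L : List C} {W : C} (h : W ∈ listStar L) : L ≠ [] := by
  rintro rfl; exact h

lemma starSet_mono {S S' T T' : Set C} (h : S ⊆ S') (h' : T ⊆ T') :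
    starSet S T ⊆ starSet S' T' := by
  rintro Z ⟨A, hA, B, hB, r⟩
  exact ⟨A, h hA, B, h' hB, r⟩

lemma starSet_eq (S T : Set C) :
    starSet S T = {Z | ObjectProperty.extensionProduct (fun x => x ∈ S) (fun x => x ∈ T) Z} := by
  ext Z
  simp only [starSet, Set.mem_ofPred_eq, ObjectProperty.extensionProduct_iff]
  constructor
  · rintro ⟨A, hA, B, hB, f, g, h, H⟩
    exact ⟨A, B, f, g, h, H, hA, hB⟩
  · rintro ⟨A, B, f, g, h, H, hA, hB⟩
    exact ⟨A, hA, B, hB, f, g, h, H⟩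

lemma starSet_iso {S T : Set C} {Z Z' : C} (e : Z ≅ Z') (h : Z ∈ starSet S T) :
    Z' ∈ starSet S T := by
  rw [starSet_eq] at h ⊢
  exact ObjectProperty.prop_of_iso
    (ObjectProperty.extensionProduct (fun x => x ∈ S) (fun x => x ∈ T)) e h

lemma starSet_assoc [IsTriangulated C] (S T U : Set C) :
    starSet (starSet S T) U = starSet S (starSet T U) := by
  simp only [starSet_eq]
  exact congrArg Set.ofPred (ObjectProperty.extensionProduct_assoc (fun x => x ∈ S) (fun x => x ∈ T) (fun x => x ∈ U))

lemma listStar_iso {L : List C} {Z Z' : C} (e : Z ≅ Z') (h : Z ∈ listStar L) :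
    Z' ∈ listStar L := by
  have hL := ne_nil_of_mem h
  revert h
  refine snocInd (P := fun L => Z ∈ listStar L → Z' ∈ listStar L) ?_ ?_ L hL
  · rintro a ⟨i⟩
    exact ⟨e.symm ≪≫ i⟩
  · intro L a hL _ h
    rw [listStar_snoc _ _ hL] at h ⊢
    exact starSet_iso e h

lemma isoClass_subset {L : List C} {Z : C} (h : Z ∈ listStar L) : isoClass Z ⊆ listStar L := by
  rintro W ⟨e⟩
  exact listStar_iso e.symm h

lemma listStar_append [IsTriangulated C] (L L' : List C) (hL : L ≠ []) (hL' : L' ≠ []) :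
    listStar (L ++ L') = starSet (listStar L) (listStar L') := by
  refine snocInd (P := fun L' => listStar (L ++ L') = starSet (listStar L) (listStar L'))
    ?_ ?_ L' hL'
  · intro a
    rw [listStar_snoc _ _ hL]; rfl
  · intro M a hM ih
    rw [← List.append_assoc, listStar_snoc _ _ (by simp [hL]), ih, listStar_snoc _ _ hM,
      starSet_assoc]

lemma listStar_map_ind {ι : Type*} (f g : ι → C) (R : C → C → Prop)
    (hbase : ∀ i W, Nonempty (W ≅ f i) → ∃ W', Nonempty (W' ≅ g i) ∧ R W W')
    (hstep : ∀ A A' B B' Z, R A A' → R B B' → Z ∈ starSet {A} {B} →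
      ∃ Z', Z' ∈ starSet (isoClass A') (isoClass B') ∧ R Z Z')
    (l : List ι) (W : C) (hW : W ∈ listStar (l.map f)) :
    ∃ W', W' ∈ listStar (l.map g) ∧ R W W' := by
  have hl : l ≠ [] := by
    have := ne_nil_of_mem hW
    simpa using this
  revert W
  refine snocInd (P := fun l => ∀ W, W ∈ listStar (l.map f) →
    ∃ W', W' ∈ listStar (l.map g) ∧ R W W') ?_ ?_ l hl
  · intro a W h
    exact hbase a W h
  · intro l a hl ih W h
    rw [List.map_append, List.map_singleton, listStar_snoc _ _ (by simpa using hl)] at h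
    obtain ⟨A, hA, B, hB, r⟩ := h
    obtain ⟨A', hA', rA⟩ := ih A hA
    obtain ⟨B', ⟨eB⟩, rB⟩ := hbase a B hB
    obtain ⟨Z', hZ', rZ⟩ := hstep A A' B B' W rA rB ⟨A, rfl, B, rfl, r⟩
    refine ⟨Z', ?_, rZ⟩
    rw [List.map_append, List.map_singleton, listStar_snoc _ _ (by simpa using hl)]
    refine starSet_mono (isoClass_subset hA') ?_ hZ'
    rintro V ⟨e⟩
    exact ⟨e ≪≫ eB⟩

lemma star_shift {A B Z : C} (n : ℤ) (h : Z ∈ starSet {A} {B}) :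
    Z⟦n⟧ ∈ starSet {A⟦n⟧} {B⟦n⟧} := by
  obtain ⟨_, rfl, _, rfl, f, g, w, H⟩ := h
  exact ⟨_, rfl, _, rfl, _, _, _, Triangle.shift_distinguished _ H n⟩

/-- The binary product over `Bool` as a biproduct. -/
noncomputable def piBoolIso (f : Bool → C) : ∏ᶜ f ≅ f true ⊞ f false where
  hom := biprod.lift (Pi.π f true) (Pi.π f false)
  inv := Pi.lift (fun j => match j with
    | true => biprod.fst
    | false => biprod.snd)
  hom_inv_id := by
    apply Pi.hom_ext
    rintro (_ | _) <;> simp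
  inv_hom_id := by
    apply biprod.hom_ext <;> simp

lemma star_sum {A B Z A' B' Z' : C} (h : Z ∈ starSet {A} {B}) (h' : Z' ∈ starSet {A'} {B'}) :
    (Z ⊞ Z') ∈ starSet (isoClass (A ⊞ A')) (isoClass (B ⊞ B')) := by
  obtain ⟨_, rfl, _, rfl, f, g, w, H⟩ := h
  obtain ⟨_, rfl, _, rfl, f', g', w', H'⟩ := h'
  let T : Bool → Triangle C := fun j => match j with
    | true => Triangle.mk f g w
    | false => Triangle.mk f' g' w'
  have hT : ∀ j, T j ∈ distTriang C := by rintro (_ | _) <;> assumption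
  have := productTriangle_distinguished T hT
  exact starSet_iso (piBoolIso (fun j => (T j).obj₂))
    ⟨_, ⟨piBoolIso (fun j => (T j).obj₁)⟩, _, ⟨piBoolIso (fun j => (T j).obj₃)⟩, _, _, _, this⟩

noncomputable def weight (t : ℝ) (l : List ℤ) : ℝ :=
  (l.map (fun n : ℤ => Real.exp ((n : ℝ) * t))).sum

lemma complexity_eq (t : ℝ) (X Y : C) :
    complexity Set.univ t X Y = sInf { c : ℝ≥0∞ | ∃ (l : List ℤ) (Y' : C), l ≠ [] ∧
      Y' ∈ (Set.univ : Set C) ∧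
      (Y ⊞ Y') ∈ listStar (l.map (fun n => (shiftFunctor C n).obj X)) ∧
      c = ENNReal.ofReal (weight t l) } := by
  have key : ∀ l : List ℤ, weight t l = (l.map (fun n => Real.exp ((n : ℝ) * t))).sum := by
    intro l
    unfold weight
    congr 1
    induction l with
    | nil => simp
    | cons a l ih => simpa using ih
  simp only [key]
  rfl

lemma complexity_le {t : ℝ} {X Y : C} {l : List ℤ} (Y' : C)
    (h : (Y ⊞ Y') ∈ listStar (l.map (fun n => (shiftFunctor C n).obj X))) :
    complexity Set.univ t X Y ≤
      ENNReal.ofReal (weight t l) := by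
  rw [complexity_eq]
  refine sInf_le ⟨l, Y', ?_, trivial, h, rfl⟩
  simpa using ne_nil_of_mem h

lemma sum_exp_nonneg (t : ℝ) (l : List ℤ) :
    0 ≤ weight t l := by
  apply List.sum_nonneg
  intro x hx
  obtain ⟨n, _, rfl⟩ := List.mem_map.1 hx
  positivity

lemma complexity_iso (t : ℝ) (X : C) {Y Z : C} (e : Y ≅ Z) :
    complexity Set.univ t X Y ≤ complexity Set.univ t X Z := by
  conv_rhs => rw [complexity_eq]
  refine le_sInf ?_
  rintro c ⟨l, Z', hl, -, h, rfl⟩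
  exact complexity_le Z' (listStar_iso (biprod.mapIso e.symm (Iso.refl Z')) h)

noncomputable def shiftBiprod (n : ℤ) (X Y : C) : (X ⊞ Y)⟦n⟧ ≅ X⟦n⟧ ⊞ Y⟦n⟧ :=
  haveI := preservesBinaryBiproduct_of_preservesBiproduct (shiftFunctor C n) X Y
  (shiftFunctor C n).mapBiprod X Y

lemma complexity_sum (t : ℝ) (X Y Z : C) :
    complexity Set.univ t (X ⊞ Y) Z ≤ complexity Set.univ t X Z := by
  conv_rhs => rw [complexity_eq]
  refine le_sInf ?_
  rintro c ⟨l, Z', hl, -, h, rfl⟩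
  obtain ⟨W', hW', V, ⟨e⟩⟩ := listStar_map_ind (fun n : ℤ => (shiftFunctor C n).obj X)
    (fun n : ℤ => (shiftFunctor C n).obj (X ⊞ Y)) (fun W W' => ∃ V, Nonempty (W' ≅ W ⊞ V))
    (by
      rintro i W ⟨e⟩
      exact ⟨_, ⟨Iso.refl _⟩, (shiftFunctor C i).obj Y,
        ⟨shiftBiprod i X Y ≪≫ biprod.mapIso e.symm (Iso.refl _)⟩⟩)
    (by
      rintro A A' B B' Z ⟨V, ⟨e⟩⟩ ⟨V', ⟨e'⟩⟩ hZ
      have hV : (V ⊞ V') ∈ starSet {V} {V'} :=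
        ⟨_, rfl, _, rfl, _, _, _, binaryBiproductTriangle_distinguished V V'⟩
      refine ⟨_, starSet_mono ?_ ?_ (star_sum hZ hV), _, ⟨Iso.refl _⟩⟩
      · rintro U ⟨i⟩
        exact ⟨i ≪≫ e.symm⟩
      · rintro U ⟨i⟩
        exact ⟨i ≪≫ e'.symm⟩) l _ h
  exact complexity_le (Z' ⊞ V) (listStar_iso (e ≪≫ biprod.associator Z Z' V) hW')

lemma complexity_shift_le (t : ℝ) (X Y : C) (n : ℤ) :
    complexity Set.univ t X ((shiftFunctor C n).obj Y) ≤
      complexity Set.univ t X Y * ENNReal.ofReal (Real.exp ((n : ℝ) * t)) := by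
  rw [← ENNReal.div_le_iff (by simp [Real.exp_pos]) (by simp)]
  conv_rhs => rw [complexity_eq]
  refine le_sInf ?_
  rintro c ⟨l, Z', hl, -, h, rfl⟩
  rw [ENNReal.div_le_iff (by simp [Real.exp_pos]) (by simp)]
  obtain ⟨W', hW', ⟨e⟩⟩ := listStar_map_ind (fun m : ℤ => (shiftFunctor C m).obj X)
    (fun m : ℤ => (shiftFunctor C (m + n)).obj X) (fun W W' => Nonempty (W' ≅ W⟦n⟧))
    (by
      rintro i W ⟨e⟩
      exact ⟨_, ⟨Iso.refl _⟩,
        ⟨(shiftFunctorAdd C i n).app X ≪≫ (shiftFunctor C n).mapIso e.symm⟩⟩)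
    (by
      rintro A A' B B' Z ⟨e⟩ ⟨e'⟩ hZ
      refine ⟨_, starSet_mono ?_ ?_ (star_shift n hZ), ⟨Iso.refl _⟩⟩
      · rintro U rfl
        exact ⟨e.symm⟩
      · rintro U rfl
        exact ⟨e'.symm⟩) l _ h
  have key : (Y⟦n⟧ ⊞ Z'⟦n⟧) ∈ listStar ((l.map (fun m => m + n)).map
      (fun m => (shiftFunctor C m).obj X)) := by
    rw [List.map_map]
    exact listStar_iso (e ≪≫ shiftBiprod n Y Z') hW'
  refine (complexity_le (t := t) _ key).trans (le_of_eq ?_)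
  rw [← ENNReal.ofReal_mul (sum_exp_nonneg t l), weight, weight, ← List.sum_map_mul_right,
    List.map_map]
  congr 3
  funext m
  simp [add_mul, Real.exp_add]

lemma complexity_shift (t : ℝ) (X Y : C) (n : ℤ) :
    complexity Set.univ t X ((shiftFunctor C n).obj Y) =
      complexity Set.univ t X Y * ENNReal.ofReal (Real.exp ((n : ℝ) * t)) := by
  refine le_antisymm (complexity_shift_le t X Y n) ?_
  have h1 := complexity_shift_le t X (Y⟦n⟧) (-n)
  have h2 := (complexity_iso t X ((shiftFunctorCompIsoId C n (-n) (by simp)).app Y).symm).trans h1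
  calc _ ≤ _ := mul_le_mul_left h2 _
    _ = _ := by
      rw [mul_assoc, ← ENNReal.ofReal_mul (Real.exp_pos _).le, ← Real.exp_add]
      simp

lemma complexity_triangle [IsTriangulated C] (t : ℝ) (X : C) {A B Y : C}
    (h : Y ∈ starSet {A} {B}) :
    complexity Set.univ t X Y ≤ complexity Set.univ t X A + complexity Set.univ t X B := by
  rw [complexity_eq t X A, complexity_eq t X B]
  rw [ENNReal.sInf_add]
  refine le_iInf₂ ?_
  rintro c ⟨l, A', hl, -, hA, rfl⟩
  rw [add_comm, ENNReal.sInf_add]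
  refine le_iInf₂ ?_
  rintro c ⟨m, B', hm, -, hB, rfl⟩
  rw [add_comm, ← ENNReal.ofReal_add (sum_exp_nonneg t l) (sum_exp_nonneg t m)]
  have hw : weight t l + weight t m = weight t (l ++ m) := by simp [weight]
  rw [hw]
  refine complexity_le (A' ⊞ B') ?_
  rw [List.map_append, listStar_append _ _ (by simpa using hl) (by simpa using hm)]
  have hV : (A' ⊞ B') ∈ starSet {A'} {B'} :=
    ⟨_, rfl, _, rfl, _, _, _, binaryBiproductTriangle_distinguished A' B'⟩
  exact starSet_mono (isoClass_subset hA) (isoClass_subset hB) (star_sum h hV)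

lemma complexity_list [IsTriangulated C] (t : ℝ) (X Y : C) (L : List C) (h : Y ∈ listStar L) :
    complexity Set.univ t X Y ≤ (L.map (fun Yi => complexity Set.univ t X Yi)).sum := by
  have hL := ne_nil_of_mem h
  revert Y
  refine snocInd (P := fun L => ∀ Y, Y ∈ listStar L → complexity Set.univ t X Y ≤
    (L.map (fun Yi => complexity Set.univ t X Yi)).sum) ?_ ?_ L hL
  · rintro a Y ⟨e⟩
    simpa using complexity_iso t X e
  · intro L a hL ih Y h
    rw [listStar_snoc _ _ hL] at h
    obtain ⟨A, hA, B, ⟨e⟩, r⟩ := h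
    rw [List.map_append, List.sum_append]
    refine (complexity_triangle t X ⟨A, rfl, B, rfl, r⟩).trans (add_le_add (ih A hA) ?_)
    simpa using complexity_iso t X e

end Helpers

end CatEntropy

/-- Basic properties of the complexity in a triangulated category `T`:
(i) `δ_t(X ⊕ Y, Z) ≤ δ_t(X, Z)`; (ii) `δ_t(X, Y[n]) = δ_t(X, Y)·e^(n t)`;
(iii) if `Y ∈ Y₁ * ⋯ * Yᵣ` then `δ_t(X, Y) ≤ ∑ δ_t(X, Yᵢ)`. -/
theorem complexity_basic_properties
    {C : Type u} [Category.{v} C] [Preadditive C] [HasZeroObject C]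
    [HasShift C ℤ] [∀ n : ℤ, (shiftFunctor C n).Additive] [Pretriangulated C]
    [IsTriangulated C] (t : ℝ) :
    (∀ X Y Z : C,
      CatEntropy.complexity Set.univ t (X ⊞ Y) Z ≤ CatEntropy.complexity Set.univ t X Z) ∧
    (∀ (X Y : C) (n : ℤ),
      CatEntropy.complexity Set.univ t X ((shiftFunctor C n).obj Y) =
        CatEntropy.complexity Set.univ t X Y * ENNReal.ofReal (Real.exp ((n : ℝ) * t))) ∧
    (∀ (X Y : C) (L : List C), Y ∈ CatEntropy.listStar L →
      CatEntropy.complexity Set.univ t X Y ≤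
        (L.map (fun Yi => CatEntropy.complexity Set.univ t X Yi)).sum) := by
  exact ⟨CatEntropy.complexity_sum t, CatEntropy.complexity_shift t,
    CatEntropy.complexity_list t⟩
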